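/- arXiv:1904.01210 — 5 statements merged into one kernel-verified Lean document; each statement's English description precedes it below -/
import Mathlib

section
/- There exists an instance on which two repeats of the IJK algorithm do not compute all shortest path distances: let n = 7 and let w be the edge-length matrix of the directed path visiting the vertices in the order 1, 2, 4, 3, 6, 7, 5 (each consecutive edge of length 1, all other entries +∞, and w(v,v) arbitrary nonnegative, e.g. +∞ off the path). Then after two runs of the IJK algorithm starting from d = w, the entry d[1,5] is strictly greater than the shortest path distance 6 from vertex 1 to vertex 5. -/
open scoped BigOperators

noncomputable section

/-- The total `d`-length of a walk, given as the list of visited vertices.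
A walk visiting at most one vertex has length `0`. -/
def walkLen {n : ℕ} (d : Fin n → Fin n → EReal) : List (Fin n) → EReal
  | [] => 0
  | [_] => 0
  | a :: b :: rest => d a b + walkLen d (b :: rest)

/-- Shortest-path distance from `s` to `t`: the infimum of walk lengths over all
finite walks from `s` to `t` (the empty walk `[s]` from `s` to `s` has length `0`). -/
def distW {n : ℕ} (d : Fin n → Fin n → EReal) (s t : Fin n) : EReal :=
  sInf {c : EReal | ∃ u : List (Fin n),
    u.head? = some s ∧ u.getLast? = some t ∧ walkLen d u = c}

/-- No negative cycles: every closed walk has nonnegative total length. -/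
def NoNegCycle {n : ℕ} (w : Fin n → Fin n → EReal) : Prop :=
  ∀ (u : List (Fin n)) (v : Fin n),
    u.head? = some v → u.getLast? = some v → 0 ≤ walkLen w u

/-- The relaxation update `d[i,j] ← min (d[i,j]) (d[i,k] + d[k,j])`,
leaving all other entries unchanged. -/
def upd {n : ℕ} (d : Fin n → Fin n → EReal) (i j k : Fin n) :
    Fin n → Fin n → EReal :=
  fun x y => if x = i ∧ y = j then min (d i j) (d i k + d k j) else d x y

/-- All triples of `Fin n` in lexicographic order. -/
def triplesLex (n : ℕ) : List (Fin n × Fin n × Fin n) :=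
  (List.finRange n).flatMap fun a =>
    (List.finRange n).flatMap fun b =>
      (List.finRange n).map fun c => (a, b, c)

/-- One run of the IJK algorithm: the triples `(i, j, k)` are processed in
lexicographic order of `(i, j, k)`, updating `d[i,j] ← min (d[i,j]) (d[i,k] + d[k,j])`. -/
def runIJK {n : ℕ} (d : Fin n → Fin n → EReal) : Fin n → Fin n → EReal :=
  (triplesLex n).foldl (fun d t => upd d t.1 t.2.1 t.2.2) d

/-- One run of the IKJ algorithm: the triples `(i, k, j)` are processed in
lexicographic order of `(i, k, j)`, updating `d[i,j] ← min (d[i,j]) (d[i,k] + d[k,j])`. -/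
def runIKJ {n : ℕ} (d : Fin n → Fin n → EReal) : Fin n → Fin n → EReal :=
  (triplesLex n).foldl (fun d t => upd d t.1 t.2.2 t.2.1) d

/-- One run of the (correct) KIJ Floyd–Warshall algorithm: the triples `(k, i, j)` are
processed in lexicographic order of `(k, i, j)`,
updating `d[i,j] ← min (d[i,j]) (d[i,k] + d[k,j])`. -/
def runKIJ {n : ℕ} (d : Fin n → Fin n → EReal) : Fin n → Fin n → EReal :=
  (triplesLex n).foldl (fun d t => upd d t.2.1 t.2.2 t.1) d

/-- The partial run of the IJK algorithm consisting of all update triples `(i, j, k)`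
with `i ≤ m`, in lexicographic order. -/
def runIJKUpto {n : ℕ} (m : Fin n) (d : Fin n → Fin n → EReal) :
    Fin n → Fin n → EReal :=
  ((triplesLex n).filter (fun t => decide (t.1 ≤ m))).foldl
    (fun d t => upd d t.1 t.2.1 t.2.2) d

/-- The partial run of the IKJ algorithm consisting of all update triples `(i, k, j)`
with `i ≤ m`, in lexicographic order. -/
def runIKJUpto {n : ℕ} (m : Fin n) (d : Fin n → Fin n → EReal) :
    Fin n → Fin n → EReal :=
  ((triplesLex n).filter (fun t => decide (t.1 ≤ m))).foldl
    (fun d t => upd d t.1 t.2.2 t.2.1) d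

/-- The `d`-length of the portion `u_a, u_{a+1}, …, u_c` of the vertex sequence `u`. -/
def pathLen {n : ℕ} (d : Fin n → Fin n → EReal) (u : ℕ → Fin n) (a c : ℕ) : EReal :=
  ∑ p ∈ Finset.Ico a c, d (u p) (u (p + 1))

/-- `u_0, …, u_l` is a shortest path w.r.t. `w`: every sub-walk `u_a, …, u_c`
has `w`-length equal to the shortest-path distance from `u_a` to `u_c`. -/
def IsShortestPath {n : ℕ} (w : Fin n → Fin n → EReal) (u : ℕ → Fin n) (l : ℕ) : Prop :=
  ∀ a c, a ≤ c → c ≤ l → pathLen w u a c = distW w (u a) (u c)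

/-- The edge lengths of the directed path visiting the vertices of `Fin 7`
(labelled `1, …, 7`) in the order `1, 2, 4, 3, 6, 7, 5`, every consecutive edge of
length `1` and all other entries `+∞`. -/
def wBadIJK : Fin 7 → Fin 7 → EReal := fun i j =>
  if (i, j) ∈ ([(0, 1), (1, 3), (3, 2), (2, 5), (5, 6), (6, 4)] :
      List (Fin 7 × Fin 7)) then 1 else ⊤

/-- A potential growing by at most `d x y` along every pair `(x, y)` grows along a walk by at
most the length of the walk. -/
theorem potential_le_add_walkLen {n : ℕ} {d : Fin n → Fin n → EReal} {p : Fin n → EReal}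
    (h : ∀ x y, p y ≤ p x + d x y) {s t : Fin n} {u : List (Fin n)}
    (hs : u.head? = some s) (ht : u.getLast? = some t) : p t ≤ p s + walkLen d u := by
  induction u generalizing s with
  | nil => simp at hs
  | cons a u ih =>
    obtain rfl : a = s := by simpa using hs
    cases u with
    | nil =>
      obtain rfl : a = t := by simpa using ht
      simp [walkLen]
    | cons b u =>
      have hb := ih (s := b) rfl (by simpa using ht)
      calc p t ≤ p b + walkLen d (b :: u) := hb
        _ ≤ p a + d a b + walkLen d (b :: u) := by gcongr; exact h a b
        _ = p a + walkLen d (a :: b :: u) := by rw [walkLen, add_assoc]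

/-- The entries outside `S` are infinite, and no entry is negative. -/
def FiniteOnlyOn {n : ℕ} (d : Fin n → Fin n → EReal) (S : List (Fin n × Fin n)) : Prop :=
  ∀ x y, 0 ≤ d x y ∧ ((x, y) ∉ S → d x y = ⊤)

/-- The effect of a relaxation update on the set of finite entries. -/
def updSupport {n : ℕ} (S : List (Fin n × Fin n)) (t : Fin n × Fin n × Fin n) :
    List (Fin n × Fin n) :=
  if (t.1, t.2.2) ∈ S ∧ (t.2.2, t.2.1) ∈ S then S.insert (t.1, t.2.1) else S

theorem FiniteOnlyOn.upd {n : ℕ} {d : Fin n → Fin n → EReal} {S : List (Fin n × Fin n)}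
    (h : FiniteOnlyOn d S) (i j k : Fin n) :
    FiniteOnlyOn (upd d i j k) (updSupport S (i, j, k)) := by
  intro x y
  have hbot (a b : Fin n) : d a b ≠ ⊥ := (EReal.bot_lt_zero.trans_le (h a b).1).ne'
  by_cases hxy : x = i ∧ y = j
  · obtain ⟨rfl, rfl⟩ := hxy
    refine ⟨by simpa [_root_.upd] using ⟨(h x y).1, add_nonneg (h x k).1 (h k y).1⟩, fun hS => ?_⟩
    have hxyS : (x, y) ∉ S := fun hm => hS (by unfold updSupport; split_ifs <;> simp [hm])
    have hk : (x, k) ∉ S ∨ (k, y) ∉ S := by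
      by_contra! hk
      exact hS (by simp [updSupport, hk])
    have hsum : d x k + d k y = ⊤ := by
      rcases hk with hk | hk
      · rw [(h x k).2 hk, EReal.top_add_of_ne_bot (hbot k y)]
      · rw [(h k y).2 hk, EReal.add_top_of_ne_bot (hbot x k)]
    simp [_root_.upd, (h x y).2 hxyS, hsum]
  · simp only [_root_.upd, if_neg hxy]
    refine ⟨(h x y).1, fun hS => (h x y).2 fun hm => hS ?_⟩
    unfold updSupport
    split_ifs <;> simp [hm]

theorem FiniteOnlyOn.foldl_upd {n : ℕ} (ts : List (Fin n × Fin n × Fin n))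
    {d : Fin n → Fin n → EReal} {S : List (Fin n × Fin n)} (h : FiniteOnlyOn d S) :
    FiniteOnlyOn (ts.foldl (fun d t => _root_.upd d t.1 t.2.1 t.2.2) d)
      (ts.foldl updSupport S) := by
  induction ts generalizing d S with
  | nil => exact h
  | cons t ts ih => exact ih (h.upd t.1 t.2.1 t.2.2)

theorem FiniteOnlyOn.runIJK {n : ℕ} {d : Fin n → Fin n → EReal} {S : List (Fin n × Fin n)}
    (h : FiniteOnlyOn d S) : FiniteOnlyOn (runIJK d) ((triplesLex n).foldl updSupport S) :=
  h.foldl_upd _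

/-- The edges of the path underlying `wBadIJK`. -/
def badPathEdges : List (Fin 7 × Fin 7) := [(0, 1), (1, 3), (3, 2), (2, 5), (5, 6), (6, 4)]

theorem finiteOnlyOn_wBadIJK : FiniteOnlyOn wBadIJK badPathEdges := by
  intro x y
  refine ⟨?_, fun h => if_neg h⟩
  unfold wBadIJK
  split_ifs <;> simp

/-- The position of each vertex on the path underlying `wBadIJK`. -/
def badPathPos : Fin 7 → ℕ := ![0, 1, 3, 2, 6, 4, 5]

theorem badPathPos_le_add_wBadIJK (x y : Fin 7) :
    (badPathPos y : EReal) ≤ badPathPos x + wBadIJK x y := by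
  by_cases h : (x, y) ∈ badPathEdges
  · have hw : wBadIJK x y = 1 := if_pos h
    have hpos : ∀ x y, (x, y) ∈ badPathEdges → badPathPos y ≤ badPathPos x + 1 := by decide
    rw [hw]
    exact_mod_cast hpos x y h
  · have hw : wBadIJK x y = ⊤ := if_neg h
    rw [hw, EReal.add_top_of_ne_bot (EReal.natCast_ne_bot _)]
    exact le_top

theorem distW_wBadIJK : distW wBadIJK 0 4 = 6 := by
  apply le_antisymm
  · refine sInf_le ⟨[0, 1, 3, 2, 5, 6, 4], rfl, rfl, ?_⟩
    simp only [walkLen, wBadIJK]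
    simp
    norm_num
  · refine le_sInf ?_
    rintro _ ⟨u, hs, ht, rfl⟩
    simpa [badPathPos] using potential_le_add_walkLen badPathPos_le_add_wBadIJK hs ht

/-- The effect of the updates `(i, ·, ·)` on the set of finite entries. -/
def updSupportRow {n : ℕ} (S : List (Fin n × Fin n)) (i : Fin n) : List (Fin n × Fin n) :=
  ((List.finRange n).flatMap fun j => (List.finRange n).map fun k => (i, j, k)).foldl updSupport S

theorem foldl_updSupport_triplesLex {n : ℕ} (S : List (Fin n × Fin n)) :
    (triplesLex n).foldl updSupport S = (List.finRange n).foldl updSupportRow S := by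
  rw [triplesLex, List.foldl_flatMap]
  rfl

/-- The finite entries of `wBadIJK` after one run of the algorithm. -/
def badSupportOne : List (Fin 7 × Fin 7) :=
  [(5, 4), (3, 6), (3, 5), (2, 6), (1, 6), (1, 5), (1, 2), (0, 3)] ++
    badPathEdges

/-- The finite entries of `wBadIJK` after two runs of the algorithm. -/
def badSupportTwo : List (Fin 7 × Fin 7) :=
  [(3, 4), (2, 4), (1, 4), (0, 6), (0, 5), (0, 2)] ++ badSupportOne

theorem foldl_updSupport_badPathEdges :
    (triplesLex 7).foldl updSupport badPathEdges = badSupportOne := by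
  have h0 : updSupportRow badPathEdges 0 =
      [(0, 3)] ++ badPathEdges := by decide +kernel
  have h1 : updSupportRow ([(0, 3)] ++ badPathEdges) 1 =
      [(1, 6), (1, 5), (1, 2), (0, 3)] ++ badPathEdges := by decide +kernel
  have h2 : updSupportRow ([(1, 6), (1, 5), (1, 2), (0, 3)] ++ badPathEdges) 2 =
      [(2, 6), (1, 6), (1, 5), (1, 2), (0, 3)] ++ badPathEdges := by decide +kernel
  have h3 : updSupportRow ([(2, 6), (1, 6), (1, 5), (1, 2), (0, 3)] ++ badPathEdges) 3 =
      [(3, 6), (3, 5), (2, 6), (1, 6), (1, 5), (1, 2), (0, 3)] ++ badPathEdges := by decide +kernel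
  have h4 :
      updSupportRow ([(3, 6), (3, 5), (2, 6), (1, 6), (1, 5), (1, 2), (0, 3)] ++ badPathEdges) 4 =
      [(3, 6), (3, 5), (2, 6), (1, 6), (1, 5), (1, 2), (0, 3)] ++ badPathEdges := by decide +kernel
  have h5 :
      updSupportRow ([(3, 6), (3, 5), (2, 6), (1, 6), (1, 5), (1, 2), (0, 3)] ++ badPathEdges) 5 =
      [(5, 4), (3, 6), (3, 5), (2, 6), (1, 6), (1, 5), (1, 2), (0, 3)] ++ badPathEdges := by
    decide +kernel
  have h6 :
      updSupportRow ([(5, 4), (3, 6), (3, 5), (2, 6), (1, 6), (1, 5), (1, 2), (0, 3)] ++ badPathEdges) 6 =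
      [(5, 4), (3, 6), (3, 5), (2, 6), (1, 6), (1, 5), (1, 2), (0, 3)] ++ badPathEdges := by
    decide +kernel
  have hrows : List.finRange 7 = [0, 1, 2, 3, 4, 5, 6] := by decide
  rw [foldl_updSupport_triplesLex, hrows]
  simp only [List.foldl_cons, List.foldl_nil]
  rw [h0, h1, h2, h3, h4, h5, h6, badSupportOne]

theorem foldl_updSupport_badSupportOne :
    (triplesLex 7).foldl updSupport badSupportOne = badSupportTwo := by
  have h0 : updSupportRow badSupportOne 0 =
      [(0, 6), (0, 5), (0, 2)] ++ badSupportOne := by decide +kernel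
  have h1 : updSupportRow ([(0, 6), (0, 5), (0, 2)] ++ badSupportOne) 1 =
      [(1, 4), (0, 6), (0, 5), (0, 2)] ++ badSupportOne := by decide +kernel
  have h2 : updSupportRow ([(1, 4), (0, 6), (0, 5), (0, 2)] ++ badSupportOne) 2 =
      [(2, 4), (1, 4), (0, 6), (0, 5), (0, 2)] ++ badSupportOne := by decide +kernel
  have h3 : updSupportRow ([(2, 4), (1, 4), (0, 6), (0, 5), (0, 2)] ++ badSupportOne) 3 =
      [(3, 4), (2, 4), (1, 4), (0, 6), (0, 5), (0, 2)] ++ badSupportOne := by decide +kernel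
  have h4 : updSupportRow ([(3, 4), (2, 4), (1, 4), (0, 6), (0, 5), (0, 2)] ++ badSupportOne) 4 =
      [(3, 4), (2, 4), (1, 4), (0, 6), (0, 5), (0, 2)] ++ badSupportOne := by decide +kernel
  have h5 : updSupportRow ([(3, 4), (2, 4), (1, 4), (0, 6), (0, 5), (0, 2)] ++ badSupportOne) 5 =
      [(3, 4), (2, 4), (1, 4), (0, 6), (0, 5), (0, 2)] ++ badSupportOne := by decide +kernel
  have h6 : updSupportRow ([(3, 4), (2, 4), (1, 4), (0, 6), (0, 5), (0, 2)] ++ badSupportOne) 6 =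
      [(3, 4), (2, 4), (1, 4), (0, 6), (0, 5), (0, 2)] ++ badSupportOne := by decide +kernel
  have hrows : List.finRange 7 = [0, 1, 2, 3, 4, 5, 6] := by decide
  rw [foldl_updSupport_triplesLex, hrows]
  simp only [List.foldl_cons, List.foldl_nil]
  rw [h0, h1, h2, h3, h4, h5, h6, badSupportTwo]

/-- On the instance `wBadIJK`, the shortest path distance from
vertex `1` to vertex `5` (i.e. from `0 : Fin 7` to `4 : Fin 7`) equals `6`, but after
two runs of the IJK algorithm the corresponding entry is strictly greater than `6`. -/
theorem ijk_two_repeats_insufficient :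
    distW wBadIJK 0 4 = 6 ∧ 6 < runIJK (runIJK wBadIJK) 0 4 := by
  refine ⟨distW_wBadIJK, ?_⟩
  have h := finiteOnlyOn_wBadIJK.runIJK.runIJK
  rw [foldl_updSupport_badPathEdges, foldl_updSupport_badSupportOne] at h
  rw [(h 0 4).2 (by decide +kernel)]
  exact EReal.coe_lt_top 6
end
end

section
/- There exists an instance on which one run of the IKJ algorithm does not compute all shortest path distances: let n = 4 and let w be the edge-length matrix of the directed path visiting the vertices in the order 1, 3, 2, 4 (each consecutive edge of length 1, all other entries +∞). Then after one run of the IKJ algorithm starting from d = w, the entry d[1,4] is strictly greater than the shortest path distance 3 from vertex 1 to vertex 4. -/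
open scoped BigOperators

noncomputable section

/-- The edge lengths of the directed path visiting the vertices of `Fin 4`
(labelled `1, 2, 3, 4`) in the order `1, 3, 2, 4`, every consecutive edge of
length `1` and all other entries `+∞`. -/
def wBadIKJ : Fin 4 → Fin 4 → EReal := fun i j =>
  if (i, j) ∈ ([(0, 2), (2, 1), (1, 3)] : List (Fin 4 × Fin 4)) then 1 else ⊤

/-- A function `q` with `q t ≤ 0` that decreases along every edge by at most its length
bounds the length of every walk ending in `t` from below. -/
lemma le_walkLen_of_potential {n : ℕ} {d : Fin n → Fin n → EReal} {q : Fin n → EReal}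
    {t : Fin n} (ht : q t ≤ 0) (hq : ∀ a b, q a ≤ d a b + q b) :
    ∀ (u : List (Fin n)) (s : Fin n), u.head? = some s → u.getLast? = some t →
      q s ≤ walkLen d u
  | [], s, hs, _ => by simp at hs
  | [a], s, hs, hl => by
      simp only [List.head?_cons, Option.some.injEq, List.getLast?_singleton] at hs hl
      subst hs hl
      exact ht
  | a :: b :: rest, s, hs, hl => by
      simp only [List.head?_cons, Option.some.injEq] at hs
      subst hs
      rw [List.getLast?_cons_cons] at hl
      exact (hq a b).trans
        (add_le_add le_rfl (le_walkLen_of_potential ht hq (b :: rest) b rfl hl))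

lemma le_distW_of_potential {n : ℕ} {d : Fin n → Fin n → EReal} {q : Fin n → EReal}
    {s t : Fin n} (ht : q t ≤ 0) (hq : ∀ a b, q a ≤ d a b + q b) : q s ≤ distW d s t := by
  refine le_sInf ?_
  rintro _ ⟨u, hs, hl, rfl⟩
  exact le_walkLen_of_potential ht hq u s hs hl

lemma distW_wBadIKJ : distW wBadIKJ 0 3 = 3 := by
  apply le_antisymm
  · refine sInf_le ⟨[0, 2, 1, 3], rfl, rfl, ?_⟩
    simp [walkLen, wBadIKJ]
    norm_num
  · refine le_distW_of_potential (q := ![3, 1, 2, 0]) (s := 0) le_rfl ?_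
    intro a b
    fin_cases a <;> fin_cases b <;> simp [wBadIKJ] <;>
      first
      | exact le_add_of_le_of_nonneg le_top (by norm_num)
      | norm_num

/-- The update `upd` on matrices over an arbitrary ordered type with addition. -/
def relax {α : Type*} [LinearOrder α] [Add α] {n : ℕ} (d : Fin n → Fin n → α)
    (i j k : Fin n) : Fin n → Fin n → α :=
  fun x y => if x = i ∧ y = j then min (d i j) (d i k + d k j) else d x y

/-- An extended natural number as an extended real number. -/
def enatToEReal (x : ℕ∞) : EReal := ((x : ENNReal) : EReal)

lemma upd_enatToEReal {n : ℕ} (d : Fin n → Fin n → ℕ∞) (i j k : Fin n) :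
    upd (fun x y => enatToEReal (d x y)) i j k =
      fun x y => enatToEReal (relax d i j k x y) := by
  have hmono : Monotone enatToEReal := fun a b h => by
    simpa [enatToEReal] using h
  funext x y
  unfold upd relax
  split_ifs
  · rw [hmono.map_min]
    simp [enatToEReal]
  · rfl

lemma foldl_upd_enatToEReal {n : ℕ} (l : List (Fin n × Fin n × Fin n))
    (d : Fin n → Fin n → ℕ∞) :
    l.foldl (fun d t => upd d t.1 t.2.2 t.2.1) (fun x y => enatToEReal (d x y)) =
      fun x y => enatToEReal
        (l.foldl (fun d t => relax d t.1 t.2.2 t.2.1) d x y) := by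
  induction l generalizing d with
  | nil => rfl
  | cons t l ih => rw [List.foldl_cons, List.foldl_cons, upd_enatToEReal, ih]

/-- The edge lengths `wBadIKJ` as extended natural numbers. -/
def wBadIKJNat : Fin 4 → Fin 4 → ℕ∞ := fun i j =>
  if (i, j) ∈ ([(0, 2), (2, 1), (1, 3)] : List (Fin 4 × Fin 4)) then 1 else ⊤

lemma wBadIKJ_eq_enatToEReal : wBadIKJ = fun i j => enatToEReal (wBadIKJNat i j) := by
  funext i j
  unfold wBadIKJ wBadIKJNat
  split_ifs <;> simp [enatToEReal]

lemma foldl_relax_wBadIKJNat :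
    (triplesLex 4).foldl (fun d t => relax d t.1 t.2.2 t.2.1) wBadIKJNat 0 3 = ⊤ := by
  decide +kernel

lemma runIKJ_wBadIKJ : runIKJ wBadIKJ 0 3 = ⊤ := by
  rw [runIKJ, wBadIKJ_eq_enatToEReal, foldl_upd_enatToEReal]
  beta_reduce
  rw [foldl_relax_wBadIKJNat]
  simp [enatToEReal]

/-- On the instance `wBadIKJ`, the shortest path distance from
vertex `1` to vertex `4` (i.e. from `0 : Fin 4` to `3 : Fin 4`) equals `3`, but after
one run of the IKJ algorithm the corresponding entry is strictly greater than `3`. -/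
theorem ikj_one_run_insufficient :
    distW wBadIKJ 0 3 = 3 ∧ 3 < runIKJ wBadIKJ 0 3 := by
  rw [distW_wBadIKJ, runIKJ_wBadIKJ]
  exact ⟨rfl, EReal.coe_lt_top 3⟩
end
end

section
/- Let n ≥ 1 and let w : Fin n → Fin n → EReal be edge lengths with no negative cycles, and let d : Fin n → Fin n → EReal be any matrix such that the shortest path distances with respect to d equal those with respect to w and d[x,y] ≥ dist_w(x,y) for all x, y. Then for any vertices i, j, k, the matrix d' obtained from d by the single update d'[i,j] = min(d[i,j], d[i,k] + d[k,j]) (with d' = d elsewhere) again satisfies: the shortest path distances with respect to d' equal those with respect to w, and d'[x,y] ≥ dist_w(x,y) for all x, y. Consequently, these two properties are invariants maintained by every update step of the KIJ, IJK, and IKJ algorithms. -/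
open scoped BigOperators

noncomputable section

theorem upd_le {n : ℕ} (d : Fin n → Fin n → EReal) (i j k x y : Fin n) :
    upd d i j k x y ≤ d x y := by
  unfold upd
  split_ifs with h
  · rw [h.1, h.2]
    exact min_le_left _ _
  · exact le_rfl

theorem walkLen_mono {n : ℕ} {d e : Fin n → Fin n → EReal} (h : ∀ x y, d x y ≤ e x y) :
    ∀ u : List (Fin n), walkLen d u ≤ walkLen e u
  | [] => le_rfl
  | [_] => le_rfl
  | a :: b :: rest => add_le_add (h a b) (walkLen_mono h (b :: rest))

theorem distW_mono {n : ℕ} {d e : Fin n → Fin n → EReal} (h : ∀ x y, d x y ≤ e x y)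
    (s t : Fin n) : distW d s t ≤ distW e s t := by
  refine le_sInf ?_
  rintro _ ⟨u, hs, ht, rfl⟩
  exact sInf_le_of_le ⟨u, hs, ht, rfl⟩ (walkLen_mono h u)

theorem distW_le_add {n : ℕ} (d : Fin n → Fin n → EReal) (i j k : Fin n) :
    distW d i j ≤ d i k + d k j :=
  sInf_le ⟨[i, k, j], rfl, rfl, by simp [walkLen]⟩

/-- Every walk can be rerouted so that its length before an update is at most its length
after the update: each use of the updated edge `(i, j)` may be expanded to `i, k, j`. -/
theorem exists_walkLen_le_upd {n : ℕ} (d : Fin n → Fin n → EReal) (i j k t : Fin n) :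
    ∀ (rest : List (Fin n)) (s : Fin n), (s :: rest).getLast? = some t →
      ∃ v : List (Fin n), (s :: v).getLast? = some t ∧
        walkLen d (s :: v) ≤ walkLen (upd d i j k) (s :: rest)
  | [], _, ht => ⟨[], ht, le_rfl⟩
  | b :: rest, s, ht => by
    rw [List.getLast?_cons_cons] at ht
    obtain ⟨v, hv, hle⟩ := exists_walkLen_le_upd d i j k t rest b ht
    by_cases h : upd d i j k s b = d s b
    · refine ⟨b :: v, by rwa [List.getLast?_cons_cons], ?_⟩
      exact add_le_add h.ge hle
    · have hsb : s = i ∧ b = j := by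
        by_contra hne
        exact h (if_neg hne)
      obtain ⟨rfl, rfl⟩ := hsb
      have hmin : upd d s b k s b = min (d s b) (d s k + d k b) := if_pos ⟨rfl, rfl⟩
      have hsum : upd d s b k s b = d s k + d k b := by
        rcases min_choice (d s b) (d s k + d k b) with hc | hc
        · exact absurd (hmin.trans hc) h
        · exact hmin.trans hc
      refine ⟨k :: b :: v, by rwa [List.getLast?_cons_cons, List.getLast?_cons_cons], ?_⟩
      simp only [walkLen]
      rw [hsum, ← add_assoc]
      exact add_le_add le_rfl hle

theorem distW_upd {n : ℕ} (d : Fin n → Fin n → EReal) (i j k s t : Fin n) :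
    distW (upd d i j k) s t = distW d s t := by
  refine le_antisymm (distW_mono (upd_le d i j k) s t) (le_sInf ?_)
  rintro _ ⟨u, hs, ht, rfl⟩
  obtain ⟨rest, rfl⟩ := List.head?_eq_some_iff.mp hs
  obtain ⟨v, hv, hle⟩ := exists_walkLen_le_upd d i j k t rest s ht
  exact sInf_le_of_le ⟨s :: v, rfl, hv, rfl⟩ hle

/-- A single relaxation update preserves the invariants:
the shortest path distances w.r.t. the current matrix equal those w.r.t. `w`, and
every entry of the current matrix is at least the corresponding `w`-distance. -/
theorem update_preserves_invariants (n : ℕ) (hn : 1 ≤ n)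
    (w : Fin n → Fin n → EReal) (hw : ∀ i j, w i j ≠ ⊥) (hncyc : NoNegCycle w)
    (d : Fin n → Fin n → EReal)
    (hdist : ∀ x y, distW d x y = distW w x y)
    (hge : ∀ x y, distW w x y ≤ d x y)
    (i j k : Fin n) :
    (∀ x y, distW (upd d i j k) x y = distW w x y) ∧
    (∀ x y, distW w x y ≤ upd d i j k x y) := by
  refine ⟨fun x y => (distW_upd d i j k x y).trans (hdist x y), fun x y => ?_⟩
  unfold upd
  split_ifs with h
  · obtain ⟨rfl, rfl⟩ := h
    exact le_min (hge x y) (hdist x y ▸ distW_le_add d x y k)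
  · exact hge x y
end
end

section
/- (Lemma 2 of the paper.) Let n ≥ 1, let w : Fin n → Fin n → EReal be edge lengths with no negative cycles, and let [u₀, u₁, …, u_l] be a shortest path with respect to w (a walk whose every sub-walk u_a, …, u_c has w-length equal to dist_w(u_a, u_c)). Suppose indices 0 ≤ a < c ≤ l satisfy u_a > u_b (as elements of Fin n) for all b with a < b < c. Run the IKJ algorithm once starting from d = w; then in the matrix obtained after completing all outer-loop iterations i = 0, 1, …, u_a (i.e., the prefix of the IKJ fold consisting of all update triples (i,k,j) with i ≤ u_a), the entry at (u_a, u_c) equals the shortest path distance dist_w(u_a, u_c). -/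
open scoped BigOperators

noncomputable section

/-- Processing one triple `(i, k, j)` of the IKJ algorithm. -/
def stepIKJ {n : ℕ} (d : Fin n → Fin n → EReal) (t : Fin n × Fin n × Fin n) :
    Fin n → Fin n → EReal :=
  upd d t.1 t.2.2 t.2.1

/-- The strict lexicographic order on triples. -/
def TripleLT {n : ℕ} (s t : Fin n × Fin n × Fin n) : Prop :=
  s.1 < t.1 ∨ s.1 = t.1 ∧ (s.2.1 < t.2.1 ∨ s.2.1 = t.2.1 ∧ s.2.2 < t.2.2)

/-- `P` lists an initial segment of the triples in strictly increasing order. -/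
def IsInitialRun {n : ℕ} (P : List (Fin n × Fin n × Fin n)) : Prop :=
  P.Pairwise TripleLT ∧ ∀ s t, TripleLT s t → t ∈ P → s ∈ P

lemma TripleLT.asymm {n : ℕ} {s t : Fin n × Fin n × Fin n} (h : TripleLT s t) :
    ¬ TripleLT t s := by
  unfold TripleLT at *
  omega

lemma triplesLex_pairwise (n : ℕ) : (triplesLex n).Pairwise TripleLT := by
  have hfin : (List.finRange n).Pairwise (· < ·) := List.pairwise_lt_finRange n
  unfold triplesLex
  rw [List.pairwise_flatMap]
  refine ⟨fun a _ => ?_, hfin.imp fun {a b} hab => ?_⟩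
  · rw [List.pairwise_flatMap]
    refine ⟨fun b _ => ?_, hfin.imp fun {b c} hbc => ?_⟩
    · rw [List.pairwise_map]
      exact hfin.imp fun hcd => Or.inr ⟨rfl, Or.inr ⟨rfl, hcd⟩⟩
    · simp only [List.mem_map]
      rintro _ ⟨x, _, rfl⟩ _ ⟨y, _, rfl⟩
      exact Or.inr ⟨rfl, Or.inl hbc⟩
  · simp only [List.mem_flatMap, List.mem_map]
    rintro _ ⟨x, _, x', _, rfl⟩ _ ⟨y, _, y', _, rfl⟩
    exact Or.inl hab

lemma mem_triplesLex {n : ℕ} (t : Fin n × Fin n × Fin n) : t ∈ triplesLex n := by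
  obtain ⟨i, k, j⟩ := t
  simp [triplesLex]

lemma isInitialRun_filter {n : ℕ} (m : Fin n) :
    IsInitialRun ((triplesLex n).filter (fun t => decide (t.1 ≤ m))) := by
  refine ⟨(triplesLex_pairwise n).filter _, fun s t hst ht => ?_⟩
  simp only [List.mem_filter, mem_triplesLex, true_and, decide_eq_true_eq] at ht ⊢
  unfold TripleLT at hst
  omega

lemma IsInitialRun.mem_of_lt {n : ℕ} {P₁ P₂ : List (Fin n × Fin n × Fin n)}
    {s t : Fin n × Fin n × Fin n} (h : IsInitialRun (P₁ ++ t :: P₂)) (hst : TripleLT s t) :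
    s ∈ P₁ := by
  have hs := h.2 s t hst (by simp)
  have hp := (List.pairwise_append.1 h.1).2.1
  rw [List.pairwise_cons] at hp
  rcases List.mem_append.1 hs with hs | hs
  · exact hs
  · rcases List.mem_cons.1 hs with rfl | hs
    · exact absurd hst hst.asymm
    · exact absurd hst (hp.1 s hs).asymm

lemma IsInitialRun.left {n : ℕ} {P₁ P₂ : List (Fin n × Fin n × Fin n)}
    {t : Fin n × Fin n × Fin n} (h : IsInitialRun (P₁ ++ t :: P₂)) : IsInitialRun P₁ := by
  obtain ⟨hp, -, hlt⟩ := List.pairwise_append.1 h.1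
  refine ⟨hp, fun r s hrs hs => ?_⟩
  have hst := hlt s hs t (by simp)
  refine h.mem_of_lt ?_
  unfold TripleLT at *
  omega

lemma stepIKJ_le {n : ℕ} (d : Fin n → Fin n → EReal) (t : Fin n × Fin n × Fin n) (x y : Fin n) :
    stepIKJ d t x y ≤ d x y := by
  unfold stepIKJ upd
  split_ifs with h
  · obtain ⟨rfl, rfl⟩ := h
    exact min_le_left _ _
  · exact le_rfl

lemma foldl_stepIKJ_le {n : ℕ} (P : List (Fin n × Fin n × Fin n)) (d : Fin n → Fin n → EReal)
    (x y : Fin n) : P.foldl stepIKJ d x y ≤ d x y := by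
  induction P generalizing d with
  | nil => exact le_rfl
  | cons t P ih => exact (ih _).trans (stepIKJ_le d t x y)

lemma foldl_stepIKJ_append_cons_le {n : ℕ} (P₁ P₂ : List (Fin n × Fin n × Fin n))
    (d : Fin n → Fin n → EReal) (i k j : Fin n) :
    (P₁ ++ (i, k, j) :: P₂).foldl stepIKJ d i j ≤
      P₁.foldl stepIKJ d i k + P₁.foldl stepIKJ d k j := by
  rw [List.foldl_append, List.foldl_cons]
  refine (foldl_stepIKJ_le _ _ _ _).trans ?_
  simp [stepIKJ, upd]

/-- The value `c` is the length of some walk from `s` to `t`. -/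
def IsWalkLength {n : ℕ} (d : Fin n → Fin n → EReal) (s t : Fin n) (c : EReal) : Prop :=
  ∃ u : List (Fin n), u.head? = some s ∧ u.getLast? = some t ∧ walkLen d u = c

lemma walkLen_append {n : ℕ} (d : Fin n → Fin n → EReal) (p q : List (Fin n)) (k : Fin n)
    (hp : p.getLast? = some k) :
    walkLen d (p ++ q) = walkLen d p + walkLen d (k :: q) := by
  induction p with
  | nil => simp at hp
  | cons x p ih =>
    cases p with
    | nil =>
      obtain rfl : x = k := by simpa using hp
      simp [walkLen]
    | cons y p =>
      have hlast : (y :: p).getLast? = some k := by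
        rwa [List.getLast?_cons_cons] at hp
      have ih := ih hlast
      simp only [List.cons_append] at ih
      simp only [List.cons_append, walkLen, ih, add_assoc]

lemma IsWalkLength.add {n : ℕ} {d : Fin n → Fin n → EReal} {s k t : Fin n} {x y : EReal}
    (hx : IsWalkLength d s k x) (hy : IsWalkLength d k t y) : IsWalkLength d s t (x + y) := by
  obtain ⟨p, hps, hpk, rfl⟩ := hx
  obtain ⟨q, hqk, hqt, rfl⟩ := hy
  obtain ⟨q, rfl⟩ := List.head?_eq_some_iff.1 hqk
  refine ⟨p ++ q, by simp [List.head?_append, hps], ?_, walkLen_append d p q k hpk⟩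
  cases q with
  | nil =>
    rw [List.append_nil, hpk]
    simpa using hqt
  | cons y q =>
    rw [List.getLast?_cons_cons] at hqt
    simp [List.getLast?_append, hqt]

lemma isWalkLength_foldl_stepIKJ {n : ℕ} (w d : Fin n → Fin n → EReal)
    (P : List (Fin n × Fin n × Fin n)) (hd : ∀ x y, IsWalkLength w x y (d x y)) (x y : Fin n) :
    IsWalkLength w x y (P.foldl stepIKJ d x y) := by
  induction P generalizing d with
  | nil => exact hd x y
  | cons t P ih =>
    refine ih _ fun x y => ?_
    unfold stepIKJ upd
    split_ifs with h
    · obtain ⟨rfl, rfl⟩ := h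
      rcases min_choice (d t.1 t.2.2) (d t.1 t.2.1 + d t.2.1 t.2.2) with h | h <;> rw [h]
      · exact hd _ _
      · exact (hd _ _).add (hd _ _)
    · exact hd x y

lemma distW_le_foldl_stepIKJ {n : ℕ} (w : Fin n → Fin n → EReal)
    (P : List (Fin n × Fin n × Fin n)) (x y : Fin n) :
    distW w x y ≤ P.foldl stepIKJ w x y :=
  sInf_le (isWalkLength_foldl_stepIKJ w w P (fun x y => ⟨[x, y], by simp [walkLen]⟩) x y)

/-- If all interior vertices of a portion of a shortest path are smaller than its first vertex,
then an initial run that has relaxed its endpoints through every interior vertex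
has found a path at least as short. -/
lemma IsShortestPath.foldl_stepIKJ_le {n : ℕ} {w : Fin n → Fin n → EReal} {u : ℕ → Fin n} {l : ℕ}
    (hsp : IsShortestPath w u l) (P : List (Fin n × Fin n × Fin n)) (hP : IsInitialRun P)
    (a c : ℕ) (hac : a < c) (hcl : c ≤ l) (hmid : ∀ b, a < b → b < c → u b < u a)
    (hmem : ∀ b, a < b → b < c → (u a, u b, u c) ∈ P) :
    P.foldl stepIKJ w (u a) (u c) ≤ pathLen w u a c := by
  induction hN : c - a using Nat.strong_induction_on generalizing a c P with
  | _ N ih =>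
    subst hN
    rcases (Finset.Ioo a c).eq_empty_or_nonempty with he | hne
    · have hca : c = a + 1 := by
        by_contra hca
        have : a + 1 ∈ Finset.Ioo a c := by
          rw [Finset.mem_Ioo]
          omega
        simp [he] at this
      subst hca
      simpa [pathLen] using _root_.foldl_stepIKJ_le P w (u a) (u (a + 1))
    · obtain ⟨m, hm, hmax⟩ := Finset.exists_max_image (Finset.Ioo a c) u hne
      obtain ⟨b₁, hb₁, hfirst⟩ := Finset.exists_min_image
        ((Finset.Ioo a c).filter (fun b => u b = u m)) id ⟨m, by simpa using hm⟩
      obtain ⟨b₂, hb₂, hlast⟩ := Finset.exists_max_image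
        ((Finset.Ioo a c).filter (fun b => u b = u m)) id ⟨m, by simpa using hm⟩
      simp only [Finset.mem_filter, Finset.mem_Ioo, id] at hm hmax hb₁ hfirst hb₂ hlast
      obtain ⟨⟨hab₁, hbc₁⟩, hub₁⟩ := hb₁
      obtain ⟨⟨hab₂, hbc₂⟩, hub₂⟩ := hb₂
      obtain ⟨P₁, P₂, rfl⟩ := List.append_of_mem (hmem m hm.1 hm.2)
      have hlt₁ : ∀ b, a < b → b < b₁ → u b < u m := fun b h h' =>
        lt_of_le_of_ne (hmax b ⟨h, by omega⟩) fun hb => by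
          have := hfirst b ⟨⟨h, by omega⟩, hb⟩
          omega
      have hlt₂ : ∀ b, b₂ < b → b < c → u b < u m := fun b h h' =>
        lt_of_le_of_ne (hmax b ⟨by omega, h'⟩) fun hb => by
          have := hlast b ⟨⟨by omega, h'⟩, hb⟩
          omega
      have h₁ := ih (b₁ - a) (by omega) P₁ hP.left a b₁ hab₁ (by omega)
        (fun b h h' => hmid b h (by omega))
        (fun b h h' => hP.mem_of_lt (Or.inr ⟨rfl, Or.inl (hlt₁ b h h')⟩)) rfl
      have h₂ := ih (c - b₂) (by omega) P₁ hP.left b₂ c hbc₂ hcl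
        (fun b h h' => hub₂ ▸ hlt₂ b h h')
        (fun b h h' => hP.mem_of_lt (Or.inl (hub₂ ▸ hmid m hm.1 hm.2))) rfl
      have heq : pathLen w u a b₁ = pathLen w u a b₂ := by
        rw [hsp a b₁ (by omega) (by omega), hsp a b₂ (by omega) (by omega), hub₁, hub₂]
      rw [hub₁, heq] at h₁
      rw [hub₂] at h₂
      refine (foldl_stepIKJ_append_cons_le P₁ P₂ w (u a) (u m) (u c)).trans
        ((add_le_add h₁ h₂).trans_eq ?_)
      exact Finset.sum_Ico_consecutive _ hab₂.le hbc₂.le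

/-- Lemma 2 of the paper. Let `u_0, …, u_l` be a shortest path and
let `a < c ≤ l` be such that `u_a > u_b` for all `a < b < c`. Then after the partial run
of the IKJ algorithm (started from `d = w`) consisting of all outer-loop iterations
`i ≤ u_a`, the entry at `(u_a, u_c)` equals the shortest path distance. -/
theorem lemma2_ikj_descent (n : ℕ) (hn : 1 ≤ n)
    (w : Fin n → Fin n → EReal) (hw : ∀ i j, w i j ≠ ⊥) (hncyc : NoNegCycle w)
    (u : ℕ → Fin n) (l : ℕ) (hsp : IsShortestPath w u l)
    (a c : ℕ) (hac : a < c) (hcl : c ≤ l)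
    (hmid : ∀ b, a < b → b < c → u b < u a) :
    runIKJUpto (u a) w (u a) (u c) = distW w (u a) (u c) := by
  refine le_antisymm ?_ (distW_le_foldl_stepIKJ w _ _ _)
  rw [← hsp a c hac.le hcl]
  refine hsp.foldl_stepIKJ_le _ (isInitialRun_filter (u a)) a c hac hcl hmid fun b _ _ => ?_
  simp [mem_triplesLex]
end
end

section
/- Let n ≥ 1 and let w : Fin n → Fin n → EReal be edge lengths with no negative cycles, let d be any matrix with dist_w(x,y) ≤ d[x,y] for all x,y, and let s = v₀, v₁, …, v_m be vertices such that d[v_p, v_{p+1}] = dist_w(v_p, v_{p+1}) for all p and Σ_p dist_w(v_p, v_{p+1}) = dist_w(s, v_m), with v₁ < v₂ < ⋯ < v_m. Then after executing, in order, the updates d[s, v_{p+1}] ← min(d[s, v_{p+1}], d[s, v_p] + d[v_p, v_{p+1}]) for p = 1, …, m−1 (as happens within the inner loops of one IJK run at outer index i = s, since the targets v₂ < v₃ < ⋯ < v_m are processed in increasing j order), the resulting matrix satisfies d[s, v_m] = dist_w(s, v_m). -/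
open scoped BigOperators

noncomputable section

theorem walkLen_ne_bot {n : ℕ} {w : Fin n → Fin n → EReal} (hw : ∀ i j, w i j ≠ ⊥) :
    ∀ u : List (Fin n), walkLen w u ≠ ⊥
  | [] => by simp [walkLen]
  | [_] => by simp [walkLen]
  | a :: b :: rest => by
    simpa [walkLen, EReal.add_eq_bot_iff, hw] using walkLen_ne_bot hw (b :: rest)

theorem walkLen_append_cons {n : ℕ} (w : Fin n → Fin n → EReal) (x : Fin n) (b : List (Fin n)) :
    ∀ a : List (Fin n), walkLen w (a ++ x :: b) = walkLen w (a ++ [x]) + walkLen w (x :: b)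
  | [] => by simp [walkLen]
  | [y] => by simp [walkLen]
  | y :: z :: a => by
    have ih := walkLen_append_cons w x b (z :: a)
    simp only [List.cons_append, walkLen] at ih ⊢
    rw [ih, add_assoc]

theorem List.exists_eq_append_cons_append_cons_of_not_nodup {α : Type*} {u : List α}
    (hu : ¬ u.Nodup) : ∃ a x b c, u = a ++ x :: (b ++ x :: c) := by
  induction u with
  | nil => simp at hu
  | cons y l ih =>
    by_cases hy : y ∈ l
    · obtain ⟨b, c, rfl⟩ := List.append_of_mem hy
      exact ⟨[], y, b, c, rfl⟩
    · obtain ⟨a, x, b, c, rfl⟩ := ih fun hl => hu (List.nodup_cons.2 ⟨hy, hl⟩)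
      exact ⟨y :: a, x, b, c, rfl⟩

/-- Without negative cycles, every walk can be shortened to a simple path. -/
theorem NoNegCycle.exists_nodup_walkLen_le {n : ℕ} {w : Fin n → Fin n → EReal}
    (hw : NoNegCycle w) (u : List (Fin n)) :
    ∃ u' : List (Fin n), u'.Nodup ∧ u'.head? = u.head? ∧ u'.getLast? = u.getLast? ∧
      walkLen w u' ≤ walkLen w u := by
  induction hk : u.length using Nat.strong_induction_on generalizing u with
  | _ k ih =>
    by_cases hu : u.Nodup
    · exact ⟨u, hu, rfl, rfl, le_rfl⟩
    obtain ⟨a, x, b, c, rfl⟩ := List.exists_eq_append_cons_append_cons_of_not_nodup hu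
    obtain ⟨u', hnd, hh, hl, hle⟩ :=
      ih (a ++ x :: c).length (by simp at hk ⊢; omega) (a ++ x :: c) rfl
    refine ⟨u', hnd, ?_, ?_, hle.trans ?_⟩
    · rw [hh]; cases a <;> simp
    · rw [hl]; simp [List.getLast?_append, List.getLast?_cons]
    · have hcyc : 0 ≤ walkLen w (x :: b ++ [x]) := hw _ x (by simp) List.getLast?_concat
      have hsplit := walkLen_append_cons w x c (x :: b)
      rw [List.cons_append] at hsplit
      rw [walkLen_append_cons w x c a, walkLen_append_cons w x (b ++ x :: c) a, hsplit]
      exact add_le_add_right (le_add_of_nonneg_left hcyc) _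

theorem NoNegCycle.distW_ne_bot {n : ℕ} {w : Fin n → Fin n → EReal}
    (hcyc : NoNegCycle w) (hw : ∀ i j, w i j ≠ ⊥) (s t : Fin n) : distW w s t ≠ ⊥ := by
  have hfin : {u : List (Fin n) | u.Nodup}.Finite :=
    (List.finite_length_le (Fin n) n).subset fun u hu => by
      simpa using List.Nodup.length_le_card hu
  set F : Set EReal := insert ⊤ (walkLen w '' {u | u.Nodup})
  have hmem : sInf F ∈ F := (Set.insert_nonempty _ _).csInf_mem ((hfin.image _).insert _)
  have hbot : sInf F ≠ ⊥ := by
    rcases hmem with h | ⟨u, -, h⟩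
    · simp [h]
    · exact h ▸ walkLen_ne_bot hw u
  refine ne_bot_of_le_ne_bot hbot (le_sInf ?_)
  rintro _ ⟨u, -, -, rfl⟩
  obtain ⟨u', hnd, -, -, hle⟩ := hcyc.exists_nodup_walkLen_le u
  have hu' : walkLen w u' ∈ F := Set.mem_insert_of_mem _ ⟨u', hnd, rfl⟩
  exact (sInf_le hu').trans hle

theorem NoNegCycle.distW_triangle {n : ℕ} {w : Fin n → Fin n → EReal}
    (hcyc : NoNegCycle w) (hw : ∀ i j, w i j ≠ ⊥) (x y z : Fin n) :
    distW w x z ≤ distW w x y + distW w y z := by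
  refine EReal.le_add_of_forall_gt (.inl (hcyc.distW_ne_bot hw x y))
    (.inr (hcyc.distW_ne_bot hw y z)) fun p hp q hq => ?_
  obtain ⟨_, ⟨u, huh, hul, rfl⟩, hup⟩ := sInf_lt_iff.1 hp
  obtain ⟨_, ⟨u', huh', hul', rfl⟩, hup'⟩ := sInf_lt_iff.1 hq
  obtain ⟨a, rfl⟩ := List.getLast?_eq_some_iff.1 hul
  obtain ⟨b, rfl⟩ := List.head?_eq_some_iff.1 huh'
  refine le_trans ?_ (add_le_add hup.le hup'.le)
  rw [← walkLen_append_cons]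
  refine sInf_le ⟨a ++ y :: b, ?_, ?_, rfl⟩
  · rw [← huh]; cases a <;> simp
  · rw [← hul']; simp [List.getLast?_append, List.getLast?_cons]

theorem upd_self_le {n : ℕ} (d : Fin n → Fin n → EReal) (i j k : Fin n) :
    upd d i j k i j ≤ d i k + d k j := by
  simp [upd]

theorem NoNegCycle.distW_le_upd {n : ℕ} {w d : Fin n → Fin n → EReal}
    (hcyc : NoNegCycle w) (hw : ∀ i j, w i j ≠ ⊥) (hge : ∀ x y, distW w x y ≤ d x y)
    (i j k x y : Fin n) : distW w x y ≤ upd d i j k x y := by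
  unfold upd
  split_ifs with h
  · rw [h.1, h.2]
    exact le_min (hge i j)
      ((hcyc.distW_triangle hw i k j).trans (add_le_add (hge i k) (hge k j)))
  · exact hge x y

/-- Relaxing along `v` from `s = v 0` bounds the entry at the end of the chain by the sum of the
original entries, while only decreasing entries and keeping them above the distances. -/
theorem NoNegCycle.foldl_upd_chain {n : ℕ} {w d : Fin n → Fin n → EReal}
    (hcyc : NoNegCycle w) (hw : ∀ i j, w i j ≠ ⊥) (hge : ∀ x y, distW w x y ≤ d x y)
    (v : ℕ → Fin n) (k : ℕ) :
    let d' := ((List.range k).map (· + 1)).foldl (fun d p => upd d (v 0) (v (p + 1)) (v p)) d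
    (∀ x y, distW w x y ≤ d' x y) ∧ (∀ x y, d' x y ≤ d x y) ∧
      d' (v 0) (v (k + 1)) ≤ ∑ p ∈ Finset.range (k + 1), d (v p) (v (p + 1)) := by
  induction k with
  | zero => simpa using hge
  | succ k ih =>
    obtain ⟨hlow, hup, hend⟩ := ih
    simp only [List.range_succ, List.map_append, List.map_cons, List.map_nil, List.foldl_append,
      List.foldl_cons, List.foldl_nil]
    refine ⟨hcyc.distW_le_upd hw hlow _ _ _, fun x y => (upd_le _ _ _ _ x y).trans (hup x y), ?_⟩
    rw [Finset.sum_range_succ]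
    exact (upd_self_le _ _ _ _).trans (add_le_add hend (hup _ _))

/-- Sequential relaxation along an increasing chain of exact entries:
if `d ≥ dist_w` entrywise, the entries `d[v_p, v_{p+1}]` are exact, the distances along
`v_0, …, v_m` add up to `dist_w(s, v_m)`, and `v_1 < v_2 < ⋯ < v_m`, then performing the
updates `d[s, v_{p+1}] ← min (d[s, v_{p+1}]) (d[s, v_p] + d[v_p, v_{p+1}])` in order for
`p = 1, …, m − 1` makes the entry at `(s, v_m)` exact. -/
theorem sequential_relaxation_along_chain (n : ℕ) (hn : 1 ≤ n)
    (w : Fin n → Fin n → EReal) (hw : ∀ i j, w i j ≠ ⊥) (hncyc : NoNegCycle w)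
    (d : Fin n → Fin n → EReal) (hge : ∀ x y, distW w x y ≤ d x y)
    (s : Fin n) (v : ℕ → Fin n) (m : ℕ) (hm : 1 ≤ m) (hv0 : v 0 = s)
    (hd : ∀ p, p < m → d (v p) (v (p + 1)) = distW w (v p) (v (p + 1)))
    (hsum : ∑ p ∈ Finset.range m, distW w (v p) (v (p + 1)) = distW w s (v m))
    (hmono : ∀ p, 0 < p → p < m → v p < v (p + 1)) :
    (((List.range (m - 1)).map (· + 1)).foldl
        (fun d p => upd d s (v (p + 1)) (v p)) d) s (v m) =
      distW w s (v m) := by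
  obtain ⟨k, rfl⟩ : ∃ k, m = k + 1 := ⟨m - 1, by omega⟩
  subst hv0
  obtain ⟨hlow, -, hend⟩ := hncyc.foldl_upd_chain hw hge v k
  refine le_antisymm (hend.trans_eq ?_) (hlow _ _)
  rw [← hsum]
  exact Finset.sum_congr rfl fun p hp => hd p (Finset.mem_range.1 hp)
end
end
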